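/- arXiv:1406.1142 — 4 statements merged into one kernel-verified Lean document; each statement's English description precedes it below -/
import Mathlib

section
/- Let ξ = M/(M+ν₂) and let Z₁, …, Z_M be independent geometric random variables with success probability ξ (so P(Zᵢ = z) = ξ(1−ξ)^{z−1} for z ≥ 1). For positive integers z₁, …, z_k with ζ = z₁ + … + z_k, the conditional probability satisfies P(Z₁ = z₁, …, Z_k = z_k | Z₁ + … + Z_M = ν₂ + M) = C(ν₂ + M − ζ − 1, M − k − 1) / C(ν₂ + M − 1, M − 1). Moreover, along any sequence of parameters with M, ν₂ → ∞, k = o(M) and kζ = o(ν₂ + M), this conditional probability is eventually at most ξ^k (1−ξ)^{ζ−k} (1 + 3kζ/(ν₂+M)). -/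
open Filter Finset
open scoped Classical

/-- The probability that independent geometric(ξ) random variables `Z₁, …, Z_M`
(on `{1,2,…}`, with `P(Z = k) = ξ(1-ξ)^{k-1}`) take the values `y₁, …, y_M`. -/
noncomputable def geomWeight (ξ : ℝ) {M : ℕ} (y : Fin M → ℕ) : ℝ :=
  ∏ i, ξ * (1 - ξ) ^ (y i - 1)

/-- With `ξ = M/(M+ν₂)` and `Z₁, …, Z_M` independent geometric(ξ) variables, this is
`P(Z₁ = z₁, …, Z_k = z_k ∣ Z₁ + … + Z_M = ν₂ + M)`. -/
noncomputable def geomCondProb (M ν₂ k : ℕ) (hk : k ≤ M) (z : Fin k → ℕ) : ℝ :=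
  (∑' y : Fin M → ℕ,
      if (∀ i, 1 ≤ y i) ∧ (∀ j : Fin k, y (Fin.castLE hk j) = z j) ∧ (∑ i, y i) = ν₂ + M
      then geomWeight ((M : ℝ) / ((M : ℝ) + (ν₂ : ℝ))) y else 0) /
  (∑' y : Fin M → ℕ,
      if (∀ i, 1 ≤ y i) ∧ (∑ i, y i) = ν₂ + M
      then geomWeight ((M : ℝ) / ((M : ℝ) + (ν₂ : ℝ))) y else 0)

lemma gc_count (q n : ℕ) (W : ℝ) :
    (∑' w : Fin (q + 1) → ℕ, if (∑ i, w i) = n then W else 0) = ((n + q).choose q : ℝ) * W := by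
  have hc : (piAntidiag (univ : Finset (Fin (q + 1))) n).card = (n + q).choose q := by
    have h := congrArg Finset.card (map_sym_eq_piAntidiag (univ : Finset (Fin (q + 1))) n)
    rw [card_map, sym_univ, card_univ, Sym.card_sym_eq_choose, Fintype.card_fin] at h
    have e : q + 1 + n - 1 = n + q := by omega
    rw [e] at h
    rw [Nat.choose_symm_add] at h
    convert h.symm
  rw [tsum_eq_sum (s := piAntidiag (univ : Finset (Fin (q + 1))) n)]
  · rw [← hc, ← nsmul_eq_mul, ← sum_const]
    apply sum_congr rfl
    intro w hw
    rw [if_pos (mem_piAntidiag.1 hw).1]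
  · intro w hw
    rw [if_neg]
    intro h
    exact hw (mem_piAntidiag.2 ⟨h, fun _ _ => mem_univ _⟩)

lemma gc_weight (ξ : ℝ) {M : ℕ} (ν : ℕ) (y : Fin M → ℕ) (h1 : ∀ i, 1 ≤ y i)
    (hs : ∑ i, y i = ν + M) : geomWeight ξ y = ξ ^ M * (1 - ξ) ^ ν := by
  unfold geomWeight
  rw [prod_mul_distrib, prod_const, card_univ, Fintype.card_fin, prod_pow_eq_pow_sum]
  congr 2
  have : ∑ i, y i = ∑ i, (y i - 1) + M := by
    calc ∑ i, y i = ∑ i, ((y i - 1) + 1) := by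
          apply sum_congr rfl
          intro i _
          have := h1 i
          omega
      _ = _ := by simp [sum_add_distrib]
  omega

lemma gc_num (ξ : ℝ) (k q ν : ℕ) (hk : k ≤ k + (q + 1)) (z : Fin k → ℕ) (hz : ∀ i, 1 ≤ z i)
    (hs : ∑ i, z i ≤ ν + k) :
    (∑' y : Fin (k + (q + 1)) → ℕ,
      if (∀ i, 1 ≤ y i) ∧ (∀ j : Fin k, y (Fin.castLE hk j) = z j) ∧
        (∑ i, y i) = ν + (k + (q + 1))
      then geomWeight ξ y else 0)
      = ((ν + k - (∑ i, z i) + q).choose q : ℝ) * (ξ ^ (k + (q + 1)) * (1 - ξ) ^ ν) := by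
  rw [← gc_count]
  have hinj : Function.Injective
      (fun w : Fin (q + 1) → ℕ => (Fin.append z (fun i => w i + 1) : Fin (k + (q + 1)) → ℕ)) := by
    intro w w' h
    funext i
    have := congrFun h (Fin.natAdd k i)
    simpa using this
  rw [← hinj.tsum_eq]
  · apply tsum_congr
    intro w
    have e : ∑ i, (Fin.append z (fun i => w i + 1) : Fin (k + (q + 1)) → ℕ) i
        = ∑ i, z i + (∑ i, w i + (q + 1)) := by
      rw [Fin.sum_univ_add]
      simp [sum_add_distrib]
    have h1 : ∀ i, 1 ≤ (Fin.append z (fun i => w i + 1) : Fin (k + (q + 1)) → ℕ) i := by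
      intro i
      refine Fin.addCases (fun j => ?_) (fun j => ?_) i
      · simpa using hz j
      · simp
    have h2 : ∀ j : Fin k,
        (Fin.append z (fun i => w i + 1) : Fin (k + (q + 1)) → ℕ) (Fin.castLE hk j) = z j := by
      intro j
      exact Fin.append_left z (fun i => w i + 1) j
    by_cases hw : ∑ i, w i = ν + k - ∑ i, z i
    · have h3 : ∑ i, (Fin.append z (fun i => w i + 1) : Fin (k + (q + 1)) → ℕ) i
          = ν + (k + (q + 1)) := by rw [e]; omega
      rw [if_pos ⟨h1, h2, h3⟩, if_pos hw, gc_weight ξ ν _ h1 h3]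
    · rw [if_neg hw, if_neg]
      rintro ⟨_, _, h3⟩
      rw [e] at h3
      omega
  · intro y hy
    rw [Function.mem_support] at hy
    have hy' := (ite_ne_right_iff.1 hy).1
    obtain ⟨h1, h2, h3⟩ := hy'
    refine ⟨fun i => y (Fin.natAdd k i) - 1, ?_⟩
    funext i
    refine Fin.addCases (fun j => ?_) (fun j => ?_) i
    · simp only [Fin.append_left]
      exact (h2 j).symm
    · have := h1 (Fin.natAdd k j)
      simp only [Fin.append_right]
      omega

lemma gc_exact (M ν₂ k : ℕ) (hk : k < M) (z : Fin k → ℕ)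
    (hz : ∀ i, 1 ≤ z i) (hs : (∑ i, z i) ≤ ν₂ + k) :
      geomCondProb M ν₂ k hk.le z
        = (Nat.choose (ν₂ + M - (∑ i, z i) - 1) (M - k - 1) : ℝ)
            / (Nat.choose (ν₂ + M - 1) (M - 1) : ℝ) := by
  obtain ⟨q, rfl⟩ : ∃ q, M = k + (q + 1) := ⟨M - k - 1, by omega⟩
  unfold geomCondProb
  rw [gc_num _ k q ν₂ hk.le z hz hs]
  have hden : ∀ (ξ : ℝ) (M : ℕ), 0 < M → (∑' y : Fin M → ℕ,
      if (∀ i, 1 ≤ y i) ∧ (∑ i, y i) = ν₂ + M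
      then geomWeight ξ y else 0) = ((ν₂ + M - 1).choose (M - 1) : ℝ) *
        (ξ ^ M * (1 - ξ) ^ ν₂) := by
    intro ξ M hM
    obtain ⟨p, rfl⟩ : ∃ p, M = p + 1 := ⟨M - 1, by omega⟩
    have hz0 : ∀ w : Fin (p + 1) → ℕ, (∀ i, 1 ≤ w i) → ∑ i, w i = ν₂ + (p + 1) →
      geomWeight ξ w = ξ ^ (p + 1) * (1 - ξ) ^ ν₂ := fun w h1 h2 => gc_weight ξ ν₂ w h1 h2
    have e1 : ν₂ + (p + 1) - 1 = ν₂ + p := by omega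
    rw [e1, Nat.add_sub_cancel, ← gc_count]
    have hinj : Function.Injective
        (fun w : Fin (p + 1) → ℕ => ((fun i => w i + 1) : Fin (p + 1) → ℕ)) := by
      intro w w' h
      funext i
      simpa using congrFun h i
    rw [← hinj.tsum_eq]
    · apply tsum_congr
      intro w
      have e : ∑ i, (w i + 1) = ∑ i, w i + (p + 1) := by simp [sum_add_distrib]
      by_cases hw : ∑ i, w i = ν₂
      · have h3 : ∑ i, (w i + 1) = ν₂ + (p + 1) := by rw [e]; omega
        have h1 : ∀ i, 1 ≤ w i + 1 := fun i => by omega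
        rw [if_pos ⟨h1, h3⟩, if_pos hw, hz0 _ h1 h3]
      · rw [if_neg hw, if_neg]
        rintro ⟨_, h3⟩
        rw [e] at h3
        omega
    · intro y hy
      rw [Function.mem_support] at hy
      have hy' := (ite_ne_right_iff.1 hy).1
      refine ⟨fun i => y i - 1, ?_⟩
      funext i
      have := hy'.1 i
      simp only
      omega
  rw [hden _ _ (by omega)]
  have hM : (0 : ℝ) < ((k + (q + 1) : ℕ) : ℝ) := by exact_mod_cast (by omega : 0 < k + (q + 1))
  generalize ((k + (q + 1) : ℕ) : ℝ) = x at hM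
  have hν : (0 : ℝ) ≤ (ν₂ : ℝ) := Nat.cast_nonneg _
  have hW : (x / (x + ν₂)) ^ (k + (q + 1)) * (1 - x / (x + ν₂)) ^ ν₂ ≠ 0 := by
    apply mul_ne_zero
    · positivity
    · rcases Nat.eq_zero_or_pos ν₂ with h | h
      · subst h; simp
      · have h' : (0 : ℝ) < (ν₂ : ℝ) := by exact_mod_cast h
        have : 1 - x / (x + ν₂) = ν₂ / (x + ν₂) := by field_simp; ring
        rw [this]
        positivity
  rw [mul_div_mul_right _ _ hW]
  have e1 : ν₂ + k - ∑ i, z i + q = ν₂ + (k + (q + 1)) - ∑ i, z i - 1 := by omega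
  have e2 : k + (q + 1) - k - 1 = q := by omega
  rw [e1, e2]

lemma gc_desc (ν N : ℕ) (h : ν ≤ N) (m : ℕ) :
    ν.descFactorial m * N ^ m ≤ ν ^ m * N.descFactorial m := by
  induction m with
  | zero => simp
  | succ m ih =>
    rw [Nat.descFactorial_succ, Nat.descFactorial_succ, pow_succ, pow_succ]
    have h1 : (ν - m) * N ≤ ν * (N - m) := by
      rw [Nat.sub_mul, Nat.mul_sub]
      have : ν * m ≤ m * N := by rw [mul_comm]; exact Nat.mul_le_mul_left _ h
      omega
    calc (ν - m) * ν.descFactorial m * (N ^ m * N)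
        = ((ν - m) * N) * (ν.descFactorial m * N ^ m) := by ring
      _ ≤ (ν * (N - m)) * (ν ^ m * N.descFactorial m) := Nat.mul_le_mul h1 ih
      _ = _ := by ring

lemma gc_choose (k q m p : ℕ) :
    (p + q).choose q * (k + q + m + p).descFactorial (k + m)
      = (k + q + m + p).choose (k + q) * ((k + q).descFactorial k * (m + p).descFactorial m) := by
  have hq := Nat.factorial_pos q
  have hp := Nat.factorial_pos p
  apply Nat.eq_of_mul_eq_mul_right (Nat.mul_pos hq hp)
  have h1 := Nat.add_choose_mul_factorial_mul_factorial p q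
  have h2 := Nat.factorial_mul_descFactorial (n := k + q + m + p) (k := k + m) (by omega)
  have h3 := Nat.factorial_mul_descFactorial (n := k + q) (k := k) (by omega)
  have h4 := Nat.factorial_mul_descFactorial (n := m + p) (k := m) (by omega)
  have h5 := Nat.add_choose_mul_factorial_mul_factorial (k + q) (m + p)
  rw [show k + q + m + p - (k + m) = p + q by omega] at h2
  rw [show k + q - k = q by omega] at h3
  rw [show m + p - m = p by omega] at h4
  rw [← Nat.choose_symm_add, ← add_assoc] at h5
  calc _ = ((p + q).choose q * p.factorial * q.factorial) *
        (k + q + m + p).descFactorial (k + m) := by ring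
    _ = (k + q + m + p).choose (k + q) * (q.factorial * (k + q).descFactorial k) *
        (p.factorial * (m + p).descFactorial m) := by rw [h1, h2, h3, h4, h5]
    _ = _ := by ring

lemma gc_bern (k : ℕ) (hk : 1 ≤ k) (ζ N : ℝ) (hζ : 0 ≤ ζ) (hN : 0 < N) (h : 6 * (k * ζ) ≤ N) :
    N ^ (k + 1) ≤ (1 + 3 * k * ζ / N) * (N - ζ) ^ (k + 1) := by
  have hk' : (1 : ℝ) ≤ k := by exact_mod_cast hk
  have hζN : ζ ≤ N := by nlinarith
  have hd : ζ / N ≤ 1 := by rw [div_le_one hN]; exact hζN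
  have hb := one_add_mul_le_pow (a := -(ζ / N)) (by linarith) (k + 1)
  have hx : k * (ζ / N) ≤ 1 / 6 := by
    rw [← mul_div_assoc, div_le_iff₀ hN]; linarith
  have hu : 0 ≤ ζ / N := by positivity
  set u := ζ / N with hu'
  have e : N - ζ = N * (1 + -u) := by rw [hu']; field_simp; ring
  rw [e, mul_pow, show 3 * k * ζ / N = 3 * (k * u) by rw [hu']; ring]
  push_cast at hb
  have h2 : 1 - 2 * (k * u) ≤ (1 + -u) ^ (k + 1) := by nlinarith
  have h0 : 0 ≤ k * u := by positivity
  have h3 : 1 ≤ (1 + 3 * (k * u)) * (1 + -u) ^ (k + 1) := by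
    calc (1 : ℝ) ≤ (1 + 3 * (k * u)) * (1 - 2 * (k * u)) := by nlinarith
      _ ≤ _ := by gcongr
  calc N ^ (k + 1) = N ^ (k + 1) * 1 := by ring
    _ ≤ N ^ (k + 1) * ((1 + 3 * (k * u)) * (1 + -u) ^ (k + 1)) := by gcongr
    _ = _ := by ring

lemma gc_bound (k q m p : ℕ) (hk : 1 ≤ k) (hN : 6 * (k * (k + m)) ≤ k + q + m + p + 1) :
    ((p + q).choose q : ℝ) / ((k + q + m + p).choose (k + q) : ℝ) ≤
      (((k + q + 1 : ℕ) : ℝ) / ((k + q + m + p + 1 : ℕ) : ℝ)) ^ k *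
      (((m + p : ℕ) : ℝ) / ((k + q + m + p + 1 : ℕ) : ℝ)) ^ m *
      (1 + 3 * k * ((k + m : ℕ) : ℝ) / ((k + q + m + p + 1 : ℕ) : ℝ)) := by
  have hc := gc_choose k q m p
  have hA := gc_desc (m + p) (k + q + m + p + 1) (by omega) m
  have ha : (k + q).descFactorial k ≤ (k + q + 1) ^ k :=
    (Nat.descFactorial_le_pow _ _).trans (Nat.pow_le_pow_left (by omega) _)
  have hB : (k + q + m + p + 1 - (k + m)) ^ (k + 1) * (k + q + m + p + 1).descFactorial m ≤
      (k + q + m + p + 1) * (k + q + m + p).descFactorial (k + m) := by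
    rw [← Nat.succ_descFactorial_succ,
      ← Nat.descFactorial_mul_descFactorial (n := k + q + m + p + 1) (k := m) (m := k + m + 1)
        (by omega)]
    apply Nat.mul_le_mul_right
    rw [show k + m + 1 - m = k + 1 by omega]
    refine le_trans (le_of_eq ?_) (Nat.pow_sub_le_descFactorial _ _)
    congr 1
    omega
  have hBpos : 0 < (k + q + m + p).descFactorial (k + m) := Nat.descFactorial_pos.2 (by omega)
  have hCpos : 0 < (k + q + m + p).choose (k + q) := Nat.choose_pos (by omega)
  have hb := gc_bern k hk ((k + m : ℕ) : ℝ) ((k + q + m + p + 1 : ℕ) : ℝ) (by positivity)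
    (by positivity) (by exact_mod_cast hN)
  rw [← Nat.cast_sub (by omega)] at hb
  have hNpos : (0 : ℝ) < ((k + q + m + p + 1 : ℕ) : ℝ) := by positivity
  generalize k + q + m + p + 1 - (k + m) = D at *
  generalize (k + q + m + p).descFactorial (k + m) = B at *
  generalize (k + q + m + p).choose (k + q) = C at *
  generalize (k + q + m + p + 1).descFactorial m = A at *
  generalize (k + q).descFactorial k = a at *
  generalize (m + p).descFactorial m = b at *
  generalize (p + q).choose q = c at *
  generalize k + q + m + p + 1 = N at *
  generalize k + q + 1 = M at *
  generalize m + p = ν at *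
  generalize k + m = ζ at *
  have hc' : (c : ℝ) * B = C * (a * b) := by exact_mod_cast hc
  have hA' : (b : ℝ) * N ^ m ≤ ν ^ m * A := by exact_mod_cast hA
  have ha' : (a : ℝ) ≤ M ^ k := by exact_mod_cast ha
  have hB' : (D : ℝ) ^ (k + 1) * A ≤ N * B := by exact_mod_cast hB
  have hBp : (0 : ℝ) < B := by exact_mod_cast hBpos
  have hCp : (0 : ℝ) < C := by exact_mod_cast hCpos
  have hE : (0 : ℝ) ≤ 1 + 3 * k * ζ / N := by positivity
  generalize (1 : ℝ) + 3 * k * ζ / N = E at *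
  have e : (c : ℝ) / C = a * b / B := by
    rw [div_eq_div_iff hCp.ne' hBp.ne']; linarith
  rw [e, div_pow, div_pow, div_le_iff₀ hBp]
  have h1 : (A : ℝ) * N ^ k ≤ E * B := by
    apply le_of_mul_le_mul_left _ hNpos
    calc (N : ℝ) * (A * N ^ k) = A * N ^ (k + 1) := by ring
      _ ≤ A * (E * D ^ (k + 1)) := by gcongr
      _ = E * (D ^ (k + 1) * A) := by ring
      _ ≤ E * (N * B) := by gcongr
      _ = N * (E * B) := by ring
  have h2 : (a : ℝ) * b * (N ^ k * N ^ m) ≤ M ^ k * ν ^ m * E * B := by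
    calc (a : ℝ) * b * (N ^ k * N ^ m) = a * (b * N ^ m) * N ^ k := by ring
      _ ≤ M ^ k * (ν ^ m * A) * N ^ k := by gcongr
      _ = M ^ k * ν ^ m * (A * N ^ k) := by ring
      _ ≤ M ^ k * ν ^ m * (E * B) := by gcongr
      _ = _ := by ring
  have h3 : (M : ℝ) ^ k / N ^ k * (ν ^ m / N ^ m) * E * B
      = (M ^ k * ν ^ m * E * B) / (N ^ k * N ^ m) := by
    field_simp
  rw [h3, le_div_iff₀ (by positivity)]
  exact h2

lemma gc_infeasible (M ν₂ k : ℕ) (hk : k < M) (z : Fin k → ℕ) (hs : ν₂ + k < ∑ i, z i) :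
    geomCondProb M ν₂ k hk.le z = 0 := by
  obtain ⟨q, rfl⟩ : ∃ q, M = k + (q + 1) := ⟨M - k - 1, by omega⟩
  unfold geomCondProb
  have : ∀ y : Fin (k + (q + 1)) → ℕ, ¬ ((∀ i, 1 ≤ y i) ∧
      (∀ j : Fin k, y (Fin.castLE hk.le j) = z j) ∧ (∑ i, y i) = ν₂ + (k + (q + 1))) := by
    rintro y ⟨h1, h2, h3⟩
    rw [Fin.sum_univ_add] at h3
    have e1 : ∑ i : Fin k, y (Fin.castAdd (q + 1) i) = ∑ i, z i :=
      sum_congr rfl (fun i _ => h2 i)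
    have e2 : q + 1 ≤ ∑ i : Fin (q + 1), y (Fin.natAdd k i) := by
      calc q + 1 = ∑ i : Fin (q + 1), 1 := by simp
        _ ≤ _ := sum_le_sum (fun i _ => h1 _)
    omega
  simp only [this, if_false, tsum_zero, zero_div]

lemma gc_main (M ν k : ℕ) (hk : k < M) (z : Fin k → ℕ) (hz : ∀ i, 1 ≤ z i)
    (hx : (k : ℝ) * (∑ i, (z i : ℝ)) / ((ν : ℝ) + (M : ℝ)) < 1 / 6) :
    geomCondProb M ν k hk.le z ≤
          ((M : ℝ) / ((M : ℝ) + (ν : ℝ))) ^ k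
            * (1 - (M : ℝ) / ((M : ℝ) + (ν : ℝ))) ^ ((∑ i, z i) - k)
            * (1 + 3 * (k : ℝ) * (∑ i, (z i : ℝ)) / ((ν : ℝ) + (M : ℝ))) := by
  have hM : (0 : ℝ) < M := by exact_mod_cast (by omega : 0 < M)
  have hxi : 1 - (M : ℝ) / ((M : ℝ) + (ν : ℝ)) = ν / (M + ν) := by field_simp; ring
  rw [hxi]
  have hkz : k ≤ ∑ i, z i := by
    calc k = ∑ i : Fin k, 1 := by simp
      _ ≤ _ := sum_le_sum (fun i _ => hz i)
  rcases lt_or_ge (ν + k) (∑ i, z i) with h | h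
  · rw [gc_infeasible M ν k hk z h]
    positivity
  · rw [gc_exact M ν k hk z hz h]
    rw [← Nat.cast_sum] at hx ⊢
    rcases Nat.eq_zero_or_pos k with h0 | h0
    · subst h0
      simp
      exact div_self_le_one _
    · obtain ⟨m, hm⟩ : ∃ m, ∑ i, z i = k + m := ⟨∑ i, z i - k, by omega⟩
      rw [hm] at h hx ⊢
      obtain ⟨p, rfl⟩ : ∃ p, ν = m + p := ⟨ν - m, by omega⟩
      obtain ⟨q, rfl⟩ : ∃ q, M = k + q + 1 := ⟨M - k - 1, by omega⟩
      rw [div_lt_iff₀ (by positivity)] at hx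
      have hN : 6 * (k * (k + m)) ≤ k + q + m + p + 1 := by
        have : (6 : ℝ) * (k * (k + m : ℕ)) ≤ (k + q + m + p + 1 : ℕ) := by
          push_cast at hx ⊢
          linarith
        exact_mod_cast this
      have := gc_bound k q m p h0 hN
      rw [show m + p + (k + q + 1) - (k + m) - 1 = p + q by omega,
        show k + q + 1 - k - 1 = q by omega,
        show m + p + (k + q + 1) - 1 = k + q + m + p by omega,
        show k + q + 1 - 1 = k + q by omega, show k + m - k = m by omega,
        ← Nat.cast_add (m + p), ← Nat.cast_add (k + q + 1),
        show m + p + (k + q + 1) = k + q + m + p + 1 by omega,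
        show k + q + 1 + (m + p) = k + q + m + p + 1 by omega]
      exact this

/-- (Exact identity) For positive integers `z₁, …, z_k` with
`ζ = z₁ + … + z_k` (feasible, i.e. `ζ ≤ ν₂ + k`) and `k < M`,
`P(Z₁ = z₁, …, Z_k = z_k ∣ ΣZ = ν₂ + M) = C(ν₂+M-ζ-1, M-k-1)/C(ν₂+M-1, M-1)`.
(Asymptotic bound) Along any sequence of parameters with `M, ν₂ → ∞`, `k = o(M)` and
`kζ = o(ν₂ + M)`, this conditional probability is eventually at most
`ξ^k (1-ξ)^{ζ-k} (1 + 3kζ/(ν₂+M))`. -/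
theorem geometric_conditional_small_coordinates :
    (∀ (M ν₂ k : ℕ) (hk : k < M) (z : Fin k → ℕ),
      (∀ i, 1 ≤ z i) → (∑ i, z i) ≤ ν₂ + k →
      geomCondProb M ν₂ k hk.le z
        = (Nat.choose (ν₂ + M - (∑ i, z i) - 1) (M - k - 1) : ℝ)
            / (Nat.choose (ν₂ + M - 1) (M - 1) : ℝ))
    ∧
    (∀ (Ms νs ks : ℕ → ℕ) (hks : ∀ t, ks t < Ms t) (zs : ∀ t, Fin (ks t) → ℕ),
      Tendsto Ms atTop atTop → Tendsto νs atTop atTop →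
      (∀ t i, 1 ≤ zs t i) →
      Tendsto (fun t => (ks t : ℝ) / (Ms t : ℝ)) atTop (nhds 0) →
      Tendsto (fun t => (ks t : ℝ) * (∑ i, (zs t i : ℝ)) / ((νs t : ℝ) + (Ms t : ℝ)))
        atTop (nhds 0) →
      ∀ᶠ t in atTop,
        geomCondProb (Ms t) (νs t) (ks t) (hks t).le (zs t) ≤
          ((Ms t : ℝ) / ((Ms t : ℝ) + (νs t : ℝ))) ^ (ks t)
            * (1 - (Ms t : ℝ) / ((Ms t : ℝ) + (νs t : ℝ))) ^ ((∑ i, zs t i) - ks t)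
            * (1 + 3 * (ks t : ℝ) * (∑ i, (zs t i : ℝ)) / ((νs t : ℝ) + (Ms t : ℝ)))) := by
  refine ⟨gc_exact, ?_⟩
  intro Ms νs ks hks zs _ _ hz _ hx
  filter_upwards [hx.eventually_lt_const (by norm_num : (0 : ℝ) < 1 / 6)] with t ht
  exact gc_main _ _ _ (hks t) (zs t) (hz t) ht
end

section
/- Let M, ν₂ → ∞ with ν₂/(M ln M) → ∞, let ξ = M/(M+ν₂), and let (ℓ₁, …, ℓ_M) be uniform over all compositions of ν₂ + M into M positive parts. Let b_m = ⌈(M+ν₂)/(M² ln M)⌉ = ⌈1/(ξ M ln M)⌉. Then P(∃ e ∈ [M] : ℓ_e < b_m) = o(1). -/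
open Filter Finset
open scoped Classical

/-- The set of compositions of `s` into `M` positive parts, encoded as functions
`Fin M → Fin (s+1)` (each part is at most `s`, so this encoding is faithful). -/
noncomputable def compSet (M s : ℕ) : Finset (Fin M → Fin (s + 1)) :=
  Finset.univ.filter fun f => (∀ i, 1 ≤ (f i : ℕ)) ∧ (∑ i, (f i : ℕ)) = s

/-- Probability of the event `Q` under the uniform distribution on compositions of `s`
into `M` positive parts. -/
noncomputable def compProb (M s : ℕ) (Q : (Fin M → ℕ) → Prop) : ℝ :=
  (((compSet M s).filter fun f => Q fun i => (f i : ℕ)).card : ℝ) / ((compSet M s).card : ℝ)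

/-- Stars and bars for `piAntidiag`. -/
lemma card_piAntidiag_aux {N : ℕ} (s : Finset (Fin N)) (n : ℕ) :
    (Finset.piAntidiag s n).card = (s.card + n - 1).choose n := by
  rw [← Finset.card_finsuppAntidiag_nat_eq_choose]
  refine Finset.card_bij' (fun g _ => Finsupp.equivFunOnFinite.symm g)
    (fun g _ => (g : Fin N → ℕ)) ?_ ?_ ?_ ?_
  · intro g hg
    rw [Finset.mem_piAntidiag] at hg
    rw [Finset.mem_finsuppAntidiag]
    refine ⟨by simpa using hg.1, ?_⟩
    intro i hi
    exact hg.2 i (by simpa using hi)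
  · intro g hg
    rw [Finset.mem_finsuppAntidiag] at hg
    rw [Finset.mem_piAntidiag]
    exact ⟨hg.1, fun i hi => hg.2 (by simpa using hi)⟩
  · intro g _
    rfl
  · intro g _
    ext i
    rfl

/-- Number of compositions. -/
lemma card_compSet_aux (m v : ℕ) :
    (compSet (m + 2) (v + (m + 2))).card = (m + 1 + v).choose (m + 1) := by
  have h1 : (compSet (m + 2) (v + (m + 2))).card
      = (Finset.piAntidiag (Finset.univ : Finset (Fin (m + 2))) v).card := by
    refine Finset.card_bij' (fun f _ => fun i => (f i : ℕ) - 1)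
      (fun g _ => fun i => Fin.ofNat (v + (m + 2) + 1) (g i + 1)) ?_ ?_ ?_ ?_
    · intro f hf
      simp only [compSet, Finset.mem_filter, Finset.mem_univ, true_and] at hf
      simp only [Finset.mem_piAntidiag, Finset.mem_univ, implies_true, and_true]
      have h : ∑ i, ((f i : ℕ) - 1 + 1) = v + (m + 2) := by
        refine Eq.trans ?_ hf.2
        exact Finset.sum_congr rfl fun i _ => Nat.sub_add_cancel (hf.1 i)
      rw [Finset.sum_add_distrib] at h
      simp at h
      omega
    · intro g hg
      simp only [Finset.mem_piAntidiag, Finset.mem_univ, implies_true, and_true] at hg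
      have hle : ∀ i, g i ≤ v := fun i => by
        rw [← hg]; exact Finset.single_le_sum (fun _ _ => Nat.zero_le _) (Finset.mem_univ i)
      have hval : ∀ i, ((Fin.ofNat (v + (m + 2) + 1) (g i + 1) : Fin _) : ℕ) = g i + 1 := by
        intro i
        simp only [Fin.ofNat]
        exact Nat.mod_eq_of_lt (by have := hle i; omega)
      simp only [compSet, Finset.mem_filter, Finset.mem_univ, true_and, hval]
      refine ⟨fun i => by omega, ?_⟩
      rw [Finset.sum_add_distrib, hg]
      simp
    · intro f hf
      simp only [compSet, Finset.mem_filter, Finset.mem_univ, true_and] at hf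
      funext i
      apply Fin.ext
      simp only [Fin.ofNat]
      rw [Nat.sub_add_cancel (hf.1 i)]
      exact Nat.mod_eq_of_lt (f i).2
    · intro g hg
      simp only [Finset.mem_piAntidiag, Finset.mem_univ, implies_true, and_true] at hg
      funext i
      have hle : g i ≤ v := by
        rw [← hg]; exact Finset.single_le_sum (fun _ _ => Nat.zero_le _) (Finset.mem_univ i)
      simp only [Fin.ofNat]
      rw [Nat.mod_eq_of_lt (by omega)]
      omega
  rw [h1, card_piAntidiag_aux, Finset.card_univ, Fintype.card_fin]
  rw [show m + 2 + v - 1 = m + 1 + v by omega, Nat.choose_symm_add]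

/-- Compositions with a prescribed part. -/
lemma card_fix_aux (m v k : ℕ) (e : Fin (m + 2)) :
    ((compSet (m + 2) (v + (m + 2))).filter fun f => (f e : ℕ) = k + 1).card
      ≤ (m + v).choose m := by
  by_cases hk : k ≤ v
  · have h1 : ((compSet (m + 2) (v + (m + 2))).filter fun f => (f e : ℕ) = k + 1).card
      ≤ (Finset.piAntidiag ((Finset.univ : Finset (Fin (m + 2))).erase e) (v - k)).card := by
      refine Finset.card_le_card_of_injOn
        (fun f => fun i => if i = e then 0 else (f i : ℕ) - 1) ?_ ?_
      · intro f hf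
        simp only [compSet, Finset.coe_filter, Finset.mem_filter, Finset.mem_univ, true_and,
          Set.mem_ofPred_eq] at hf
        simp only [Finset.mem_coe, Finset.mem_piAntidiag, Finset.mem_erase, Finset.mem_univ,
          and_true]
        obtain ⟨⟨hf1, hf2⟩, hf3⟩ := hf
        constructor
        · have h : ∑ i, ((f i : ℕ) - 1 + 1) = v + (m + 2) := by
            refine Eq.trans ?_ hf2
            exact Finset.sum_congr rfl fun i _ => Nat.sub_add_cancel (hf1 i)
          rw [Finset.sum_add_distrib] at h
          rw [← Finset.add_sum_erase _ _ (Finset.mem_univ e)] at h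
          have h2 : ∑ i ∈ Finset.univ.erase e, (if i = e then 0 else (f i : ℕ) - 1)
              = ∑ i ∈ Finset.univ.erase e, ((f i : ℕ) - 1) :=
            Finset.sum_congr rfl fun i hi => if_neg (Finset.ne_of_mem_erase hi)
          rw [h2]
          simp at h
          omega
        · intro i hi hie
          simp [hie] at hi
      · intro f hf g hg hfg
        simp only [compSet, Finset.coe_filter, Finset.mem_filter, Finset.mem_univ, true_and,
          Set.mem_ofPred_eq] at hf hg
        funext i
        apply Fin.ext
        by_cases hi : i = e
        · subst hi; rw [hf.2, hg.2]
        · have := congrFun hfg i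
          simp only [hi, if_false] at this
          have a := hf.1.1 i
          have b := hg.1.1 i
          omega
    refine h1.trans ?_
    rw [card_piAntidiag_aux, Finset.card_erase_of_mem (Finset.mem_univ e),
      Finset.card_univ, Fintype.card_fin,
      show m + 2 - 1 + (v - k) - 1 = m + (v - k) by omega, ← Nat.choose_symm_add]
    exact Nat.choose_le_choose m (by omega)
  · rw [Finset.card_eq_zero.2]
    · exact Nat.zero_le _
    · rw [Finset.filter_eq_empty_iff]
      intro f hf he
      simp only [compSet, Finset.mem_filter, Finset.mem_univ, true_and] at hf
      obtain ⟨hf1, hf2⟩ := hf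
      have h : ∑ i, ((f i : ℕ) - 1 + 1) = v + (m + 2) := by
        refine Eq.trans ?_ hf2
        exact Finset.sum_congr rfl fun i _ => Nat.sub_add_cancel (hf1 i)
      rw [Finset.sum_add_distrib, ← Finset.add_sum_erase _ _ (Finset.mem_univ e)] at h
      simp at h
      omega

lemma card_event_aux (m v b : ℕ) :
    ((compSet (m + 2) (v + (m + 2))).filter fun f => ∃ e, (f e : ℕ) < b).card
      ≤ (m + 2) * ((b - 1) * (m + v).choose m) := by
  have hsub : ((compSet (m + 2) (v + (m + 2))).filter fun f => ∃ e, (f e : ℕ) < b)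
      ⊆ (Finset.univ : Finset (Fin (m + 2))).biUnion fun e => (Finset.range (b - 1)).biUnion
        fun k => (compSet (m + 2) (v + (m + 2))).filter fun f => (f e : ℕ) = k + 1 := by
    intro f hf
    rw [Finset.mem_filter] at hf
    obtain ⟨hf, e, he⟩ := hf
    have h1 : 1 ≤ (f e : ℕ) := by
      simp only [compSet, Finset.mem_filter, Finset.mem_univ, true_and] at hf
      exact hf.1 e
    simp only [Finset.mem_biUnion, Finset.mem_univ, true_and, Finset.mem_range, Finset.mem_filter]
    exact ⟨e, (f e : ℕ) - 1, by omega, hf, by omega⟩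
  refine (Finset.card_le_card hsub).trans ?_
  refine (Finset.card_biUnion_le_card_mul _ _ _ fun e _ =>
    (Finset.card_biUnion_le_card_mul _ _ _ fun k _ => card_fix_aux m v k e)).trans ?_
  simp

lemma compProb_bound_aux (m v : ℕ) :
    compProb (m + 2) (v + (m + 2)) (fun ℓ => ∃ e : Fin (m + 2),
        ℓ e < ⌈(((m + 2 : ℕ) : ℝ) + (v : ℝ)) /
          (((m + 2 : ℕ) : ℝ) ^ 2 * Real.log ((m + 2 : ℕ) : ℝ))⌉₊)
      ≤ (Real.log ((m + 2 : ℕ) : ℝ))⁻¹ := by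
  have hL : 0 < Real.log ((m + 2 : ℕ) : ℝ) := by
    apply Real.log_pos; push_cast; have : (0 : ℝ) ≤ m := Nat.cast_nonneg m
    linarith
  set L := Real.log ((m + 2 : ℕ) : ℝ) with hLdef
  set x := (((m + 2 : ℕ) : ℝ) + (v : ℝ)) / (((m + 2 : ℕ) : ℝ) ^ 2 * L) with hx
  have hxpos : 0 < x := by positivity
  have hb : ((⌈x⌉₊ - 1 : ℕ) : ℝ) ≤ x := by
    have h1 : 1 ≤ ⌈x⌉₊ := Nat.ceil_pos.2 hxpos
    have := Nat.ceil_lt_add_one hxpos.le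
    push_cast [Nat.cast_sub h1]
    linarith
  have hc := card_event_aux m v ⌈x⌉₊
  have hch := Nat.add_one_mul_choose_eq (m + v) m
  rw [show m + v + 1 = m + 1 + v by omega] at hch
  have hpos : 0 < (m + 1 + v).choose (m + 1) := Nat.choose_pos (by omega)
  unfold compProb
  rw [card_compSet_aux]
  generalize (m + 1 + v).choose (m + 1) = T at *
  generalize (m + v).choose m = C at *
  have hT : (0 : ℝ) < T := by exact_mod_cast hpos
  have hch' : ((m : ℝ) + 1 + v) * C = T * (m + 1) := by exact_mod_cast hch
  rw [div_le_iff₀ hT]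
  have hc' : ((((compSet (m + 2) (v + (m + 2))).filter
      fun f => ∃ e, (f e : ℕ) < ⌈x⌉₊).card : ℕ) : ℝ)
      ≤ ((m : ℝ) + 2) * (((⌈x⌉₊ - 1 : ℕ) : ℝ) * C) := by exact_mod_cast hc
  refine le_trans (b := ((m : ℝ) + 2) * (((⌈x⌉₊ - 1 : ℕ) : ℝ) * C)) (by convert hc'; rfl) ?_
  have hm0 : (0 : ℝ) ≤ m := Nat.cast_nonneg m
  have hv0 : (0 : ℝ) ≤ v := Nat.cast_nonneg v
  have hC : (C : ℝ) = T * (m + 1) / (m + 1 + v) := by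
    rw [eq_div_iff (by positivity)]; linarith
  calc ((m : ℝ) + 2) * (((⌈x⌉₊ - 1 : ℕ) : ℝ) * C) ≤ ((m : ℝ) + 2) * (x * C) := by gcongr
    _ = L⁻¹ * T * (((m : ℝ) + 2 + v) * (m + 1) / ((m + 2) * (m + 1 + v))) := by
      rw [hC, hx]; push_cast; field_simp
    _ ≤ L⁻¹ * T * 1 := by
      gcongr
      rw [div_le_one (by positivity)]
      nlinarith
    _ = L⁻¹ * T := mul_one _

/-- If `M, ν₂ → ∞` with `ν₂/(M ln M) → ∞` and `(ℓ₁, …, ℓ_M)` is uniform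
over all compositions of `ν₂ + M` into `M` positive parts, then with
`b_m = ⌈(M+ν₂)/(M² ln M)⌉` we have `P(∃ e, ℓ_e < b_m) = o(1)`. -/
theorem no_short_edge
    (M ν : ℕ → ℕ)
    (hM : Tendsto M atTop atTop) (hν : Tendsto ν atTop atTop)
    (hratio : Tendsto (fun t => (ν t : ℝ) / ((M t : ℝ) * Real.log (M t))) atTop atTop) :
    Tendsto (fun t => compProb (M t) (ν t + M t)
      (fun ℓ => ∃ e : Fin (M t),
        ℓ e < ⌈((M t : ℝ) + (ν t : ℝ)) / ((M t : ℝ) ^ 2 * Real.log (M t))⌉₊))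
      atTop (nhds 0) := by
  have hlim : Tendsto (fun t => (Real.log (M t : ℝ))⁻¹) atTop (nhds 0) :=
    tendsto_inv_atTop_zero.comp
      (Real.tendsto_log_atTop.comp (tendsto_natCast_atTop_atTop.comp hM))
  refine tendsto_of_tendsto_of_tendsto_of_le_of_le' tendsto_const_nhds hlim ?_ ?_
  · exact Eventually.of_forall fun t => by unfold compProb; positivity
  · filter_upwards [hM.eventually_ge_atTop 2] with t ht
    obtain ⟨m, hm⟩ := Nat.exists_eq_add_of_le' ht
    rw [hm]
    exact compProb_bound_aux m (ν t)
end

section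
/- Let M, ν₂ → ∞ with ν₂ ≤ e^{M^{o(1)}}, let m = M + ν₂, ξ = M/m, and let (ℓ_e)_{e∈[M]} be uniform over all compositions of m into M positive parts. Let ε > 0 be a sufficiently small constant; in particular any ε ≤ ε₁ works, where ε₁ is the solution of ε^{3/2} e^{1/(6ε^{1/2})} = 20. Then with high probability there is no subset S ⊆ [M] with |S| ≤ εM and Σ_{e∈S} ℓ_e ≥ ε^{1/2} M/ξ. -/
open Filter Finset
open scoped Classical

lemma mc_step (j s : ℕ) : (j + s) * Nat.multichoose j s = j * Nat.multichoose (j+1) s := by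
  rcases j with _ | j
  · rcases s with _ | s
    · simp
    · simp [Nat.multichoose_zero_succ]
  · rw [Nat.multichoose_eq, Nat.multichoose_eq]
    have h := Nat.add_one_mul_choose_eq (j + s) j
    have e1 : j + 1 + s - 1 = j + s := by omega
    have e2 : j + 1 + 1 + s - 1 = j + s + 1 := by omega
    rw [e1, e2]
    rw [Nat.choose_symm_add, Nat.choose_symm_of_eq_add (show j+s+1 = (j+1)+s by omega)] at h
    linarith

lemma mc_asc (k s r : ℕ) : (k + s).ascFactorial r * Nat.multichoose k s
    = k.ascFactorial r * Nat.multichoose (k + r) s := by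
  induction r with
  | zero => simp
  | succ r ih =>
    rw [Nat.ascFactorial_succ, Nat.ascFactorial_succ, mul_assoc, ih, ← add_assoc]
    have := mc_step (k + r) s
    calc _ = k.ascFactorial r * ((k + r + s) * Nat.multichoose (k+r) s) := by ring
      _ = _ := by rw [this]; ring

lemma card_pa {ι : Type*} [DecidableEq ι] (s : Finset ι) (n : ℕ) :
    (piAntidiag s n).card = Nat.multichoose s.card n := by
  induction s using Finset.cons_induction generalizing n with
  | empty => rcases n with _ | n <;> simp
  | cons i s hi ih =>
    rw [piAntidiag_cons, card_disjiUnion]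
    simp only [card_map, ih, card_cons]
    rw [Finset.Nat.sum_antidiagonal_eq_sum_range_succ_mk]
    rw [← Finset.sum_range_reflect]
    simp only []
    clear ih
    induction n with
    | zero => simp
    | succ n ih =>
      rw [Finset.sum_range_succ, Nat.multichoose_succ_succ, ← ih, add_comm]
      simp
      apply Finset.sum_congr rfl
      intro x hx
      simp at hx
      congr 1
      omega

lemma split_pa {ι : Type*} [DecidableEq ι] (S T : Finset ι) (h : Disjoint S T) (n : ℕ) (w : ℕ → ℕ) :
    ∑ y ∈ piAntidiag (S ∪ T) n, w (∑ i ∈ S, y i) =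
    ∑ p ∈ antidiagonal n, w p.1 * (Nat.multichoose S.card p.1 * Nat.multichoose T.card p.2) := by
  have hST : ∀ i ∈ T, i ∉ S := fun i hi hi' => (Finset.disjoint_left.1 h) hi' hi
  rw [← Finset.sum_fiberwise_of_maps_to (g := fun y => (∑ i ∈ S, y i, ∑ i ∈ T, y i))
    (t := antidiagonal n)]
  · apply Finset.sum_congr rfl
    rintro ⟨s, t⟩ hp
    rw [Finset.sum_congr rfl (g := fun _ => w s)
      (by intro y hy; simp at hy; simp [hy.2.1])]
    rw [sum_const, smul_eq_mul, mul_comm, ← card_pa, ← card_pa, ← card_product]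
    congr 1
    rw [HasAntidiagonal.mem_antidiagonal] at hp
    simp only at hp
    apply Finset.card_nbij' (fun y => ((fun i => if i ∈ S then y i else 0), (fun i => if i ∈ T then y i else 0)))
      (fun q i => q.1 i + q.2 i)
    · intro y hy
      simp at hy ⊢
      refine ⟨⟨?_, ?_⟩, ?_, ?_⟩
      · exact hy.2.1
      · tauto
      · exact hy.2.2
      · tauto
    · rintro ⟨a, b⟩ hq
      simp at hq ⊢
      obtain ⟨⟨h1, h2⟩, h3, h4⟩ := hq
      have e1 : ∑ i ∈ S, (a i + b i) = s := by
        rw [← h1]; apply Finset.sum_congr rfl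
        intro i hi
        by_contra hb
        exact hST i (h4 i (by omega)) hi
      have e2 : ∑ i ∈ T, (a i + b i) = t := by
        rw [← h3]; apply Finset.sum_congr rfl
        intro i hi
        by_contra hb
        exact hST i hi (h2 i (by omega))
      refine ⟨⟨?_, ?_⟩, e1, e2⟩
      · rw [Finset.sum_union h, e1, e2, hp]
      · intro i hi
        by_cases ha : a i = 0
        · exact Or.inr (h4 i (hi ha))
        · exact Or.inl (h2 i ha)
    · intro y hy
      simp at hy
      funext i
      have := hy.1.2 i
      have := hST i
      by_cases hS : i ∈ S <;> by_cases hT : i ∈ T <;> simp_all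
    · rintro ⟨a, b⟩ hq
      simp at hq
      obtain ⟨⟨h1, h2⟩, h3, h4⟩ := hq
      have ha : ∀ i, i ∉ S → a i = 0 := fun i hi => by
        by_contra hn; exact hi (h2 i hn)
      have hb : ∀ i, i ∉ T → b i = 0 := fun i hi => by
        by_contra hn; exact hi (h4 i hn)
      ext i
      · by_cases hS : i ∈ S
        · have hT : i ∉ T := fun hT => hST i hT hS
          simp [hS, hb i hT]
        · simp [hS, ha i hS]
      · by_cases hT : i ∈ T
        · simp [hT, ha i (hST i hT)]
        · simp [hT, hb i hT]
  · intro y hy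
    simp only [mem_piAntidiag] at hy
    rw [HasAntidiagonal.mem_antidiagonal, ← hy.1, Finset.sum_union h]

lemma vand (a b n : ℕ) : ∑ p ∈ antidiagonal n, (Nat.multichoose a p.1 * Nat.multichoose b p.2)
    = Nat.multichoose (a + b) n := by
  have h : Disjoint (Finset.range a) (Finset.Ico a (a+b)) := by
    rw [Finset.disjoint_left]; intro i; simp; omega
  have := split_pa _ _ h n (fun _ => 1)
  simp only [one_mul, card_range, Nat.card_Ico, add_tsub_cancel_left] at this
  rw [← this, ← card_eq_sum_ones, card_pa, card_union_of_disjoint h]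
  simp

/-- Rising factorial moments of the sum over `S`. -/
lemma moment (M n r : ℕ) (S : Finset (Fin M)) :
    ∑ y ∈ piAntidiag (univ : Finset (Fin M)) n, (S.card + ∑ i ∈ S, y i).ascFactorial r =
      S.card.ascFactorial r * Nat.multichoose (M + r) n := by
  have := split_pa S Sᶜ disjoint_compl_right n (fun s => (S.card + s).ascFactorial r)
  rw [union_compl] at this
  rw [this]
  have hc : S.card + Sᶜ.card = M := by simpa using Finset.card_add_card_compl S
  have hc' : M + r = (S.card + r) + Sᶜ.card := by omega
  rw [hc', ← vand, Finset.mul_sum]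
  apply Finset.sum_congr rfl
  intro p _
  rw [← mul_assoc, mc_asc, mul_assoc]

lemma comp_card (M n : ℕ) (Q : (Fin M → ℕ) → Prop) :
    ((compSet M (n + M)).filter fun f => Q fun i => (f i : ℕ)).card =
    ((piAntidiag (univ : Finset (Fin M)) n).filter fun y => Q fun i => y i + 1).card := by
  refine Finset.card_bij' (fun f _ i => (f i : ℕ) - 1)
    (fun y hy i => (⟨y i + 1, by
      simp at hy
      have h1 : y i ≤ n := by
        rw [← hy.1]; exact Finset.single_le_sum (fun _ _ => Nat.zero_le _) (mem_univ i)
      have := i.2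
      omega⟩ : Fin (n + M + 1))) ?_ ?_ ?_ ?_
  · intro f hf
    simp only [compSet, mem_filter, mem_univ, true_and, mem_piAntidiag] at hf ⊢
    obtain ⟨⟨h1, h2⟩, h3⟩ := hf
    have e : ∀ i, (f i : ℕ) - 1 + 1 = f i := fun i => Nat.sub_add_cancel (h1 i)
    refine ⟨⟨?_, by simp⟩, ?_⟩
    · have : ∑ i, ((f i : ℕ) - 1 + 1) = n + M := by simp only [e, h2]
      rw [Finset.sum_add_distrib] at this
      simpa using this
    · simpa only [e] using h3
  · intro y hy
    simp only [compSet, mem_filter, mem_univ, true_and, mem_piAntidiag] at hy ⊢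
    refine ⟨⟨by simp, ?_⟩, hy.2⟩
    rw [Finset.sum_add_distrib, hy.1.1]; simp
  · intro f hf
    simp only [compSet, mem_filter, mem_univ, true_and] at hf
    funext i
    ext
    exact Nat.sub_add_cancel (hf.1.1 i)
  · intro y hy
    funext i; simp

lemma tail (M n r L : ℕ) (S : Finset (Fin M)) :
    ((piAntidiag (univ : Finset (Fin M)) n).filter fun y => L ≤ ∑ i ∈ S, (y i + 1)).card
      * L.ascFactorial r ≤ S.card.ascFactorial r * Nat.multichoose (M + r) n := by
  rw [← moment, ← smul_eq_mul, ← Finset.sum_const]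
  refine (Finset.sum_le_sum ?_).trans (Finset.sum_le_sum_of_subset (Finset.filter_subset _ _))
  intro y hy
  rw [mem_filter] at hy
  apply Nat.ascFactorial_le
  have := hy.2
  rw [Finset.sum_add_distrib] at this
  simp at this
  omega

lemma union_bound (M n r L k : ℕ) (hk : k ≤ M) (hM : 0 < M) (hL : 0 < L)
    (hr : ∀ i < r, 3 * ((k + i) * (n + M + i)) ≤ (M + i) * (L + i))
    (Q : (Fin M → ℕ) → Prop)
    (hQ : ∀ l, (∀ i, 1 ≤ l i) → Q l → ∃ S : Finset (Fin M), S.card = k ∧ L ≤ ∑ i ∈ S, l i) :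
    compProb M (n + M) Q ≤ (M.choose k : ℝ) / 3 ^ r := by
  have hT : (compSet M (n + M)).card = Nat.multichoose M n := by
    have := comp_card M n (fun _ => True)
    simpa [card_pa] using this
  have hTpos : 0 < Nat.multichoose M n := by
    rw [Nat.multichoose_eq]; apply Nat.choose_pos; omega
  unfold compProb
  rw [comp_card, hT]
  set B := ((piAntidiag (univ : Finset (Fin M)) n).filter fun y => Q fun i => y i + 1) with hB
  have h1 : B ⊆ (powersetCard k (univ : Finset (Fin M))).biUnion (fun S =>
      (piAntidiag (univ : Finset (Fin M)) n).filter fun y => L ≤ ∑ i ∈ S, (y i + 1)) := by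
    intro y hy
    rw [hB, mem_filter] at hy
    obtain ⟨S, hS, hS'⟩ := hQ _ (by simp) hy.2
    rw [mem_biUnion]
    refine ⟨S, by simp [mem_powersetCard, hS], ?_⟩
    rw [mem_filter]
    exact ⟨hy.1, hS'⟩
  have h2 : B.card * L.ascFactorial r ≤
      M.choose k * (k.ascFactorial r * Nat.multichoose (M + r) n) := by
    calc _ ≤ (∑ S ∈ powersetCard k (univ : Finset (Fin M)),
          ((piAntidiag (univ : Finset (Fin M)) n).filter
            fun y => L ≤ ∑ i ∈ S, (y i + 1)).card) * L.ascFactorial r :=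
          Nat.mul_le_mul_right _ ((card_le_card h1).trans card_biUnion_le)
      _ ≤ ∑ S ∈ powersetCard k (univ : Finset (Fin M)),
          (k.ascFactorial r * Nat.multichoose (M + r) n) := by
          rw [Finset.sum_mul]
          apply Finset.sum_le_sum
          intro S hS
          have := tail M n r L S
          rwa [(mem_powersetCard.1 hS).2] at this
      _ = _ := by simp
  have h3 := mc_asc M n r
  have h4 : 3 ^ r * (k.ascFactorial r * (n + M).ascFactorial r) ≤
      M.ascFactorial r * L.ascFactorial r := by
    simp only [Nat.ascFactorial_eq_prod_range, ← Finset.prod_mul_distrib]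
    have : (3 : ℕ) ^ r = ∏ i ∈ range r, 3 := by simp
    rw [this, ← Finset.prod_mul_distrib]
    apply Finset.prod_le_prod
    · intro i _; positivity
    · intro i hi
      exact hr i (mem_range.1 hi)
  have hpos : 0 < M.ascFactorial r * L.ascFactorial r := by
    simp only [Nat.ascFactorial_eq_prod_range]
    apply Nat.mul_pos <;> apply Finset.prod_pos <;> intros <;> omega
  have h5 : B.card * 3 ^ r ≤ M.choose k * Nat.multichoose M n := by
    apply Nat.le_of_mul_le_mul_right _ hpos
    rw [add_comm M n] at h3
    calc B.card * 3 ^ r * (M.ascFactorial r * L.ascFactorial r)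
        = 3 ^ r * M.ascFactorial r * (B.card * L.ascFactorial r) := by ring
      _ ≤ 3 ^ r * M.ascFactorial r * (M.choose k * (k.ascFactorial r * Nat.multichoose (M + r) n)) :=
        Nat.mul_le_mul_left _ h2
      _ = M.choose k * (3 ^ r * k.ascFactorial r) * (M.ascFactorial r * Nat.multichoose (M + r) n) := by
        ring
      _ = M.choose k * Nat.multichoose M n * (3 ^ r * (k.ascFactorial r * (n + M).ascFactorial r)) := by
        rw [← h3]; ring
      _ ≤ _ := Nat.mul_le_mul_left _ h4
  rw [div_le_div_iff₀ (by exact_mod_cast hTpos) (by positivity)]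
  exact_mod_cast h5

lemma choose_bound (M k : ℕ) (ε : ℝ) (h0 : 0 < ε) (h1 : ε < 1) (hk : (k : ℝ) ≤ ε * M) (hkM : k ≤ M) :
    (M.choose k : ℝ) ≤ Real.exp (M * (ε * (1 - Real.log ε))) := by
  have h : (M.choose k : ℝ) * ε ^ k ≤ (ε + 1) ^ M := by
    rw [add_pow]
    have := Finset.single_le_sum (f := fun j => ε ^ j * 1 ^ (M - j) * (M.choose j : ℝ))
      (fun i _ => by positivity) (mem_range.2 (Nat.lt_succ_of_le hkM))
    simp only [one_pow, mul_one] at this ⊢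
    linarith
  have h2 : (ε + 1) ^ M ≤ Real.exp (M * ε) := by
    rw [Real.exp_nat_mul]
    exact pow_le_pow_left₀ (by positivity) (Real.add_one_le_exp ε) M
  have h3 : ε ^ k = Real.exp (k * Real.log ε) := by
    rw [Real.exp_nat_mul, Real.exp_log h0]
  have hl : Real.log ε ≤ 0 := Real.log_nonpos h0.le h1.le
  have h4 : Real.exp (ε * M * Real.log ε) ≤ ε ^ k := by
    rw [h3]; apply Real.exp_le_exp.2; nlinarith
  have h5 : (M.choose k : ℝ) * Real.exp (ε * M * Real.log ε) ≤ Real.exp (M * ε) :=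
    (mul_le_mul_of_nonneg_left h4 (by positivity)).trans (h.trans h2)
  have h6 : Real.exp (M * (ε * (1 - Real.log ε))) =
      Real.exp (M * ε) / Real.exp (ε * M * Real.log ε) := by
    rw [← Real.exp_sub]; congr 1; ring
  rw [h6, le_div_iff₀ (Real.exp_pos _)]
  exact h5

lemma eps_facts (ε : ℝ) (hε0 : 0 < ε) (hε1 : ε < 1)
    (hεsmall : 20 ≤ ε ^ ((3 : ℝ) / 2) * Real.exp (1 / (6 * Real.sqrt ε))) :
    0 < (Real.sqrt ε / 3 - ε) - ε * (1 - Real.log ε) := by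
  have hx : 0 < Real.sqrt ε := Real.sqrt_pos.2 hε0
  have hxx : Real.sqrt ε * Real.sqrt ε = ε := Real.mul_self_sqrt hε0.le
  have hl : Real.log ε < 0 := Real.log_neg hε0 hε1
  have h20 : Real.exp 2 ≤ 20 := by
    have : Real.exp 2 = Real.exp 1 * Real.exp 1 := by rw [← Real.exp_add]; norm_num
    have := Real.exp_one_lt_d9
    have := Real.exp_pos 1
    nlinarith
  rw [Real.rpow_def_of_pos hε0, ← Real.exp_add] at hεsmall
  have h := Real.exp_le_exp.1 (h20.trans hεsmall)
  set x := Real.sqrt ε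
  have hu : 1 / (6 * x) * (6 * x) = 1 := by field_simp
  have h' : (2 - Real.log ε * (3/2)) * (6 * x) ≤ 1 := by
    rw [← hu]; exact mul_le_mul_of_nonneg_right (by linarith) (by positivity)
  have hx12 : 12 * x ≤ 1 := by nlinarith
  rw [← hxx] at *
  have : 0 < x * (1/3 - 2 * x + x * Real.log (x * x)) := by
    apply mul_pos hx; nlinarith
  nlinarith

/-- Let `M, ν₂ → ∞` with `ν₂ ≤ e^{M^{o(1)}}`, `m = M + ν₂`, `ξ = M/m`,
and let `(ℓ_e)` be uniform over compositions of `m` into `M` positive parts.  For any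
sufficiently small constant `ε > 0` — any `ε ≤ ε₁` works, where `ε₁` solves
`ε^{3/2} e^{1/(6√ε)} = 20`, i.e. any `0 < ε < 1` with `20 ≤ ε^{3/2} e^{1/(6√ε)}` —
with high probability there is no `S ⊆ [M]` with `|S| ≤ εM` and `∑_{e∈S} ℓ_e ≥ ε^{1/2} M/ξ`. -/
theorem no_small_set_of_edges_with_large_total_length
    (M ν : ℕ → ℕ)
    (hM : Tendsto M atTop atTop) (hν : Tendsto ν atTop atTop)
    (hsub : ∃ f : ℕ → ℝ, Tendsto f atTop (nhds 0) ∧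
      ∀ᶠ t in atTop, (ν t : ℝ) ≤ Real.exp ((M t : ℝ) ^ (f t)))
    (ε : ℝ) (hε0 : 0 < ε) (hε1 : ε < 1)
    (hεsmall : 20 ≤ ε ^ ((3 : ℝ) / 2) * Real.exp (1 / (6 * Real.sqrt ε))) :
    Tendsto (fun t => compProb (M t) (ν t + M t)
      (fun ℓ => ∃ S : Finset (Fin (M t)), (S.card : ℝ) ≤ ε * (M t : ℝ) ∧
        Real.sqrt ε * (M t : ℝ) / ((M t : ℝ) / ((M t : ℝ) + (ν t : ℝ))) ≤ ∑ e ∈ S, (ℓ e : ℝ)))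
      atTop (nhds 0) := by
  have hδ := eps_facts ε hε0 hε1 hεsmall
  have hx : 0 < Real.sqrt ε := Real.sqrt_pos.2 hε0
  have hx1 : Real.sqrt ε < 1 := by
    rw [Real.sqrt_lt' one_pos]; simpa using hε1
  have hl : Real.log ε < 0 := Real.log_neg hε0 hε1
  set x := Real.sqrt ε
  set c := x / 3 - ε with hc
  have hc0 : 0 < c := by nlinarith
  set δ := c - ε * (1 - Real.log ε) with hδd
  have hlim : Tendsto (fun t => Real.exp (1 - δ * (M t : ℝ))) atTop (nhds 0) := by
    apply Real.tendsto_exp_atBot.comp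
    have h1 : Tendsto (fun t => δ * (M t : ℝ)) atTop atTop :=
      Tendsto.const_mul_atTop hδ (tendsto_natCast_atTop_atTop.comp hM)
    simpa [sub_eq_add_neg] using
      tendsto_atBot_add_const_left atTop 1 (tendsto_neg_atTop_atBot.comp h1)
  refine tendsto_of_tendsto_of_tendsto_of_le_of_le' tendsto_const_nhds hlim ?_ ?_
  · exact Eventually.of_forall fun t => by unfold compProb; positivity
  filter_upwards [hM.eventually_gt_atTop 0] with t ht
  generalize M t = m at *
  generalize ν t = n at *
  have hm : (0 : ℝ) < m := by exact_mod_cast ht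
  have hn : (0 : ℝ) ≤ n := by positivity
  have hkle : ((⌊ε * m⌋₊ : ℕ) : ℝ) ≤ ε * m := Nat.floor_le (by positivity)
  have hkm : ⌊ε * m⌋₊ ≤ m := by
    have : ((⌊ε * m⌋₊ : ℕ) : ℝ) ≤ m := by nlinarith
    exact_mod_cast this
  have hrle : ((⌊c * m⌋₊ : ℕ) : ℝ) ≤ c * m := Nat.floor_le (by positivity)
  have hrge : c * m < (⌊c * m⌋₊ : ℕ) + 1 := Nat.lt_floor_add_one _
  have hLge : x * (m + n) ≤ (⌈x * (m + n)⌉₊ : ℕ) := Nat.le_ceil _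
  have hLpos : 0 < ⌈x * ((m : ℝ) + n)⌉₊ := Nat.ceil_pos.2 (by positivity)
  have key := union_bound m n ⌊c * m⌋₊ ⌈x * ((m : ℝ) + n)⌉₊ ⌊ε * m⌋₊ hkm ht hLpos ?_
    (fun ℓ => ∃ S : Finset (Fin m), (S.card : ℝ) ≤ ε * (m : ℝ) ∧
        x * (m : ℝ) / ((m : ℝ) / ((m : ℝ) + (n : ℝ))) ≤ ∑ e ∈ S, (ℓ e : ℝ)) ?_
  · refine key.trans ?_
    have h1 := choose_bound m ⌊ε * m⌋₊ ε hε0 hε1 hkle hkm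
    have h3 : Real.exp (c * m - 1) ≤ 3 ^ ⌊c * m⌋₊ := by
      calc Real.exp (c * m - 1) ≤ Real.exp ((⌊c * m⌋₊ : ℕ) * 1) :=
            Real.exp_le_exp.2 (by linarith)
        _ = Real.exp 1 ^ ⌊c * m⌋₊ := by rw [Real.exp_nat_mul]
        _ ≤ _ := pow_le_pow_left₀ (Real.exp_pos _).le
            (by have := Real.exp_one_lt_d9; linarith) _
    have h4 : Real.exp (1 - δ * m) =
        Real.exp (m * (ε * (1 - Real.log ε))) / Real.exp (c * m - 1) := by
      rw [← Real.exp_sub, hδd]; congr 1; ring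
    rw [h4]
    exact div_le_div₀ (Real.exp_pos _).le h1 (Real.exp_pos _) h3
  · intro i hi
    have hi' : (i : ℝ) ≤ ⌊c * m⌋₊ := by exact_mod_cast hi.le
    have hi0 : (0 : ℝ) ≤ i := by positivity
    have a1 : 3 * (((⌊ε * m⌋₊ : ℕ) : ℝ) + i) ≤ x * (m + i) := by
      have : 3 * (ε * m + c * m) = x * m := by rw [hc]; ring
      nlinarith
    have a2 : x * ((n : ℝ) + m + i) ≤ (⌈x * ((m : ℝ) + n)⌉₊ : ℕ) + i := by nlinarith
    have : (3 : ℝ) * ((((⌊ε * m⌋₊ : ℕ) : ℝ) + i) * (n + m + i)) ≤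
        (m + i) * ((⌈x * ((m : ℝ) + n)⌉₊ : ℕ) + i) := by
      calc _ = (3 * (((⌊ε * m⌋₊ : ℕ) : ℝ) + i)) * (n + m + i) := by ring
        _ ≤ x * (m + i) * (n + m + i) := mul_le_mul_of_nonneg_right a1 (by positivity)
        _ = (m + i) * (x * (n + m + i)) := by ring
        _ ≤ _ := mul_le_mul_of_nonneg_left a2 (by positivity)
    exact_mod_cast this
  · rintro l hl1 ⟨S, hS, hS'⟩
    have hSk : S.card ≤ ⌊ε * m⌋₊ := Nat.le_floor hS
    obtain ⟨S', hSS', hS'c⟩ := Finset.exists_superset_card_eq hSk (by simpa using hkm)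
    refine ⟨S', hS'c, ?_⟩
    apply le_trans _ (Finset.sum_le_sum_of_subset hSS')
    apply Nat.ceil_le.2
    have e : x * (m : ℝ) / ((m : ℝ) / ((m : ℝ) + (n : ℝ))) = x * (m + n) := by
      field_simp
    rw [e] at hS'
    exact_mod_cast hS'
end

section
/- Let T be a tree consisting of a root v and k paths P₁, P₂, …, P_k of lengths ℓ₁, …, ℓ_k (edges) all having v as a common endpoint and no other common vertices. Consider a simple random walk on T started at v, and let Λ be the expected time for the walk to first reach a leaf (an endpoint of some Pᵢ other than v). Then: (a) Λ = (ℓ₁ + … + ℓ_k) / (Σ_{i=1}^k ℓᵢ^{-1}); and (b) if ℓᵢ ≤ ℓ for all i = 1, …, k, then Λ ≤ ℓ². -/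
open Finset
open scoped Classical ENNReal

/-- Vertices of the "star of paths": a root together with, for each `i < k`, a path of
`ℓ i` further vertices; the vertex `(i, j)` is at distance `j + 1` from the root and
`(i, ℓ i - 1)` is the leaf at the end of the `i`-th path. -/
def StarV (k : ℕ) (ℓ : Fin k → ℕ) : Type := Unit ⊕ (Σ i : Fin k, Fin (ℓ i))

instance (k : ℕ) (ℓ : Fin k → ℕ) : Fintype (StarV k ℓ) := by unfold StarV; infer_instance
instance (k : ℕ) (ℓ : Fin k → ℕ) : DecidableEq (StarV k ℓ) := by unfold StarV; infer_instance

/-- Edge-multiplicity (adjacency) function of the star of paths. -/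
def starAdj (k : ℕ) (ℓ : Fin k → ℕ) : StarV k ℓ → StarV k ℓ → ℕ
  | Sum.inl _, Sum.inl _ => 0
  | Sum.inl _, Sum.inr p => if (p.2 : ℕ) = 0 then 1 else 0
  | Sum.inr p, Sum.inl _ => if (p.2 : ℕ) = 0 then 1 else 0
  | Sum.inr p, Sum.inr q =>
      if (p.1 : ℕ) = (q.1 : ℕ) ∧ ((p.2 : ℕ) + 1 = (q.2 : ℕ) ∨ (q.2 : ℕ) + 1 = (p.2 : ℕ))
      then 1 else 0

/-- One-step transition probability of the simple random walk on a multigraph with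
edge multiplicities `c`. -/
noncomputable def stepP {V : Type} [Fintype V] (c : V → V → ℕ) (u v : V) : ℝ≥0∞ :=
  (c u v : ℝ≥0∞) / ((∑ w, c u w : ℕ) : ℝ≥0∞)

/-- Probability of a given trajectory of the random walk. -/
noncomputable def trajP {V : Type} [Fintype V] (c : V → V → ℕ) {t : ℕ}
    (w : Fin (t + 1) → V) : ℝ≥0∞ :=
  ∏ i : Fin t, stepP c (w i.castSucc) (w i.succ)

/-- `v` is a leaf of the star of paths. -/
def isLeaf (k : ℕ) (ℓ : Fin k → ℕ) : StarV k ℓ → Prop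
  | Sum.inl _ => False
  | Sum.inr p => (p.2 : ℕ) + 1 = ℓ p.1

/-- Expected time for the simple random walk on the star of paths, started at the root,
to first reach a leaf:  `Λ = Σ_{t ≥ 0} P(no leaf reached in the first t steps)`. -/
noncomputable def expHitLeaf (k : ℕ) (ℓ : Fin k → ℕ) : ℝ≥0∞ :=
  ∑' t : ℕ,
    ∑ w ∈ (Finset.univ : Finset (Fin (t + 1) → StarV k ℓ)).filter
      (fun w => w 0 = Sum.inl () ∧ ∀ j, ¬ isLeaf k ℓ (w j)),
      trajP (starAdj k ℓ) w

/-- Killed one-step operator. -/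
noncomputable def killQ (k : ℕ) (ℓ : Fin k → ℕ) (f : StarV k ℓ → ℝ≥0∞) (u : StarV k ℓ) : ℝ≥0∞ :=
  if isLeaf k ℓ u then 0 else ∑ v, stepP (starAdj k ℓ) u v * f v

/-- Survival probability. -/
noncomputable def surv (k : ℕ) (ℓ : Fin k → ℕ) : ℕ → StarV k ℓ → ℝ≥0∞
  | 0 => fun u => if isLeaf k ℓ u then 0 else 1
  | t + 1 => killQ k ℓ (surv k ℓ t)

theorem walk_sum_eq_surv (k : ℕ) (ℓ : Fin k → ℕ) (t : ℕ) : ∀ u : StarV k ℓ,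
    ∑ w ∈ (Finset.univ : Finset (Fin (t + 1) → StarV k ℓ)).filter
      (fun w => w 0 = u ∧ ∀ j, ¬ isLeaf k ℓ (w j)), trajP (starAdj k ℓ) w = surv k ℓ t u := by
  induction t with
  | zero =>
    intro u
    rw [Finset.sum_filter,
      ← Equiv.sum_comp (Equiv.funUnique (Fin 1) (StarV k ℓ)).symm]
    simp only [surv, trajP]
    rw [Finset.sum_eq_single u]
    · by_cases h : isLeaf k ℓ u <;> simp [h]
    · intro b _ hb
      simp [hb]
    · simp
  | succ t ih =>
    intro u
    rw [Finset.sum_filter,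
      ← Equiv.sum_comp (Fin.consEquiv (fun _ : Fin (t + 2) => StarV k ℓ)), Fintype.sum_prod_type,
      Finset.sum_eq_single u]
    · have key : ∀ w : Fin (t + 1) → StarV k ℓ,
          trajP (starAdj k ℓ) (Fin.cons (α := fun _ => StarV k ℓ) u w : Fin (t + 2) → StarV k ℓ)
            = stepP (starAdj k ℓ) u (w 0) * trajP (starAdj k ℓ) w := by
        intro w
        unfold trajP
        rw [Fin.prod_univ_succ]
        simp
      simp only [Fin.consEquiv, Equiv.coe_fn_mk, key, Fin.cons_zero, true_and, Fin.forall_fin_succ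
        (n := t + 1), Fin.cons_succ]
      simp only [surv, killQ]
      by_cases h : isLeaf k ℓ u
      · simp [h]
      · simp only [h, not_false_eq_true, true_and, if_false]
        simp only [← ih, Finset.sum_filter, Finset.mul_sum]
        rw [Finset.sum_comm]
        refine Finset.sum_congr rfl fun w _ => ?_
        rw [Finset.sum_eq_single (w 0)]
        · by_cases h2 : ∀ j, ¬ isLeaf k ℓ (w j) <;> simp [h2]
        · intro b _ hb
          simp [hb.symm]
        · simp
    · intro b _ hb
      simp [Fin.consEquiv, hb]
    · simp

theorem killQ_add (k : ℕ) (ℓ : Fin k → ℕ) (f g : StarV k ℓ → ℝ≥0∞) (u : StarV k ℓ) :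
    killQ k ℓ (fun v => f v + g v) u = killQ k ℓ f u + killQ k ℓ g u := by
  unfold killQ
  split_ifs
  · simp
  · simp [mul_add, Finset.sum_add_distrib]

theorem killQ_mono (k : ℕ) (ℓ : Fin k → ℕ) (f g : StarV k ℓ → ℝ≥0∞) (h : ∀ v, f v ≤ g v)
    (u : StarV k ℓ) : killQ k ℓ f u ≤ killQ k ℓ g u := by
  unfold killQ
  split_ifs
  · simp
  · exact Finset.sum_le_sum fun v _ => mul_le_mul_right (h v) _

theorem killQ_smul (k : ℕ) (ℓ : Fin k → ℕ) (C : ℝ≥0∞) (f : StarV k ℓ → ℝ≥0∞) (u : StarV k ℓ) :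
    killQ k ℓ (fun v => C * f v) u = C * killQ k ℓ f u := by
  unfold killQ
  split_ifs
  · simp
  · rw [Finset.mul_sum]
    exact Finset.sum_congr rfl fun v _ => by ring

theorem killQ_sum (k : ℕ) (ℓ : Fin k → ℕ) (t : ℕ) (f : ℕ → StarV k ℓ → ℝ≥0∞) (u : StarV k ℓ) :
    killQ k ℓ (fun v => ∑ s ∈ range t, f s v) u = ∑ s ∈ range t, killQ k ℓ (f s) u := by
  induction t with
  | zero => simp [killQ]
  | succ t ih => simp only [Finset.sum_range_succ, killQ_add, ih]

/-- Verification principle. -/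
theorem tsum_surv_eq (k : ℕ) (ℓ : Fin k → ℕ) (h : StarV k ℓ → ℝ≥0∞) (hfin : ∀ u, h u ≠ ⊤)
    (hh : ∀ u, h u = surv k ℓ 0 u + killQ k ℓ h u) (u : StarV k ℓ) :
    ∑' t, surv k ℓ t u = h u := by
  have hleaf : ∀ u, isLeaf k ℓ u → h u = 0 := by
    intro u hu
    rw [hh u]
    simp [surv, killQ, hu]
  set C : ℝ≥0∞ := ∑ u, h u with hC
  have hCfin : C ≠ ⊤ := by
    rw [hC]
    exact ENNReal.sum_ne_top.2 fun u _ => hfin u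
  have hle : ∀ u, h u ≤ C * surv k ℓ 0 u := by
    intro u
    by_cases hu : isLeaf k ℓ u
    · simp [hleaf u hu]
    · simp only [surv, hu, if_false, mul_one]
      exact Finset.single_le_sum (f := h) (fun _ _ => zero_le) (Finset.mem_univ u)
  have hlow : ∀ t u, ∑ s ∈ range t, surv k ℓ s u ≤ h u := by
    intro t
    induction t with
    | zero => simp
    | succ t ih =>
      intro u
      rw [Finset.sum_range_succ', hh u, add_comm]
      refine add_le_add le_rfl ?_
      have := killQ_mono k ℓ _ _ ih u
      rw [killQ_sum] at this
      exact this
  have hup : ∀ t u, h u ≤ ∑ s ∈ range t, surv k ℓ s u + C * surv k ℓ t u := by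
    intro t
    induction t with
    | zero => simpa using hle
    | succ t ih =>
      intro u
      have := killQ_mono k ℓ _ _ ih u
      rw [killQ_add, killQ_sum, killQ_smul] at this
      rw [Finset.sum_range_succ', hh u, add_comm (surv k ℓ 0 u), add_right_comm]
      exact add_le_add this le_rfl
  have h1 : ∑' t, surv k ℓ t u ≤ h u := by
    rw [ENNReal.tsum_eq_iSup_nat]
    exact iSup_le fun t => hlow t u
  refine le_antisymm h1 ?_
  have hne : ∑' t, surv k ℓ t u ≠ ⊤ := ne_top_of_le_ne_top (hfin u) h1
  have h0 := ENNReal.tendsto_atTop_zero_of_tsum_ne_top hne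
  have h2 : Filter.Tendsto (fun t => ∑' s, surv k ℓ s u + C * surv k ℓ t u) Filter.atTop
      (nhds (∑' s, surv k ℓ s u + C * 0)) :=
    tendsto_const_nhds.add (ENNReal.Tendsto.const_mul h0 (Or.inr hCfin))
  rw [mul_zero, add_zero] at h2
  refine ge_of_tendsto' h2 fun t => (hup t u).trans ?_
  exact add_le_add (ENNReal.sum_le_tsum _) le_rfl

/-- Function on the star given by functions on the arms. -/
noncomputable def armF (k : ℕ) (ℓ : Fin k → ℕ) (a : ℝ≥0∞) (H : Fin k → ℕ → ℝ≥0∞) :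
    StarV k ℓ → ℝ≥0∞
  | Sum.inl _ => a
  | Sum.inr p => H p.1 (p.2 + 1)

theorem sum_star_aux (k : ℕ) (ℓ : Fin k → ℕ) (f : Unit ⊕ (Σ i : Fin k, Fin (ℓ i)) → ℝ≥0∞) :
    ∑ v, f v = f (Sum.inl ()) + ∑ i : Fin k, ∑ j : Fin (ℓ i), f (Sum.inr ⟨i, j⟩) := by
  rw [Fintype.sum_sum_type, Fintype.sum_sigma]
  simp

theorem sum_star (k : ℕ) (ℓ : Fin k → ℕ) (f : StarV k ℓ → ℝ≥0∞) :
    ∑ v, f v = f (Sum.inl ()) + ∑ i : Fin k, ∑ j : Fin (ℓ i), f (Sum.inr ⟨i, j⟩) := by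
  have : ∑ v, f v = ∑ v : Unit ⊕ (Σ i : Fin k, Fin (ℓ i)), f v := by
    refine Finset.sum_congr ?_ fun _ _ => rfl
    ext x
    exact ⟨fun _ => Finset.mem_univ _, fun _ => Finset.mem_univ _⟩
  exact this.trans (sum_star_aux k ℓ f)

theorem nbr_root (k : ℕ) (ℓ : Fin k → ℕ) (hℓ : ∀ i, 1 ≤ ℓ i) (a : ℝ≥0∞)
    (H : Fin k → ℕ → ℝ≥0∞) :
    ∑ v, (starAdj k ℓ (Sum.inl ()) v : ℝ≥0∞) * armF k ℓ a H v = ∑ i, H i 1 := by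
  rw [sum_star]
  simp only [starAdj, armF, Nat.cast_zero, zero_mul, zero_add]
  refine Finset.sum_congr rfl fun i _ => ?_
  rw [Finset.sum_eq_single ⟨0, hℓ i⟩]
  · simp
  · intro b _ hb
    have : (b : ℕ) ≠ 0 := fun h => hb (Fin.ext h)
    simp [this]
  · simp

theorem nbr_arm (k : ℕ) (ℓ : Fin k → ℕ) (a : ℝ≥0∞)
    (H : Fin k → ℕ → ℝ≥0∞) (ha : ∀ i, H i 0 = a) (i : Fin k) (j : Fin (ℓ i))
    (hj : (j : ℕ) + 1 < ℓ i) :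
    ∑ v, (starAdj k ℓ (Sum.inr ⟨i, j⟩) v : ℝ≥0∞) * armF k ℓ a H v
      = H i j + H i (j + 2) := by
  rw [sum_star]
  simp only [starAdj, armF]
  rw [Finset.sum_eq_single i]
  · simp only [true_and]
    rw [Fin.sum_univ_eq_sum_range (fun m => (((if (j : ℕ) + 1 = m ∨ m + 1 = (j : ℕ) then 1 else 0 : ℕ)) : ℝ≥0∞)
      * H i (m + 1)) (ℓ i)]
    have e : ∀ m, (((if (j : ℕ) + 1 = m ∨ m + 1 = (j : ℕ) then 1 else 0 : ℕ)) : ℝ≥0∞) * H i (m + 1)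
        = (if (j : ℕ) + 1 = m then H i (m + 1) else 0)
          + (if m + 1 = (j : ℕ) then H i (m + 1) else 0) := by
      intro m
      by_cases h1 : (j : ℕ) + 1 = m
      · have h2 : ¬ (m + 1 = (j : ℕ)) := by omega
        simp [h1, h2]
      · by_cases h2 : m + 1 = (j : ℕ) <;> simp [h1, h2]
    simp only [e, Finset.sum_add_distrib]
    rw [Finset.sum_ite_eq, if_pos (Finset.mem_range.2 hj), add_comm (H i (_ + 1)), ← add_assoc]
    congr 1
    rcases Nat.eq_zero_or_pos (j : ℕ) with h0 | h0
    · simp [h0, ha]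
    · rw [Finset.sum_eq_single ((j : ℕ) - 1)]
      · have : (j : ℕ) - 1 + 1 = j := by omega
        simp [this, h0.ne']
      · intro b _ hb
        rw [if_neg (by omega)]
      · intro hb
        exact absurd (Finset.mem_range.2 (by omega)) hb
  · intro b _ hb
    refine Finset.sum_eq_zero fun m _ => ?_
    have : ¬ ((i : ℕ) = (b : ℕ)) := fun h => hb (Fin.ext h.symm)
    simp [this]
  · simp

theorem armF_one (k : ℕ) (ℓ : Fin k → ℕ) (v : StarV k ℓ) :
    armF k ℓ 1 (fun _ _ => 1) v = 1 := by
  cases v <;> rfl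

theorem deg_root (k : ℕ) (ℓ : Fin k → ℕ) (hℓ : ∀ i, 1 ≤ ℓ i) :
    ((∑ w, starAdj k ℓ (Sum.inl ()) w : ℕ) : ℝ≥0∞) = k := by
  have := nbr_root k ℓ hℓ 1 (fun _ _ => 1)
  simp only [armF_one, mul_one] at this
  rw [Nat.cast_sum, this]
  simp

theorem deg_arm (k : ℕ) (ℓ : Fin k → ℕ) (i : Fin k) (j : Fin (ℓ i))
    (hj : (j : ℕ) + 1 < ℓ i) :
    ((∑ w, starAdj k ℓ (Sum.inr ⟨i, j⟩) w : ℕ) : ℝ≥0∞) = 2 := by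
  have := nbr_arm k ℓ 1 (fun _ _ => 1) (fun _ => rfl) i j hj
  simp only [armF_one, mul_one] at this
  rw [Nat.cast_sum, this]
  norm_num

theorem step_sum (k : ℕ) (ℓ : Fin k → ℕ) (u : StarV k ℓ) (f : StarV k ℓ → ℝ≥0∞) :
    ∑ v, stepP (starAdj k ℓ) u v * f v
      = (∑ v, (starAdj k ℓ u v : ℝ≥0∞) * f v) / ((∑ w, starAdj k ℓ u w : ℕ) : ℝ≥0∞) := by
  simp only [stepP, div_eq_mul_inv]
  rw [Finset.sum_mul]
  exact Finset.sum_congr rfl fun v _ => by ring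

theorem killQ_nonleaf (k : ℕ) (ℓ : Fin k → ℕ) (f : StarV k ℓ → ℝ≥0∞) (u : StarV k ℓ)
    (hu : ¬ isLeaf k ℓ u) (x d : ℝ≥0∞) (hx : ∑ v, (starAdj k ℓ u v : ℝ≥0∞) * f v = x)
    (hd : ((∑ w, starAdj k ℓ u w : ℕ) : ℝ≥0∞) = d) (hf : f u = 1 + x / d) :
    f u = surv k ℓ 0 u + killQ k ℓ f u := by
  simp only [surv, killQ, if_neg hu]
  rw [step_sum, hx, hd, hf]

theorem killQ_leaf (k : ℕ) (ℓ : Fin k → ℕ) (f : StarV k ℓ → ℝ≥0∞) (u : StarV k ℓ)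
    (hu : isLeaf k ℓ u) (hf : f u = 0) :
    f u = surv k ℓ 0 u + killQ k ℓ f u := by
  simp [surv, killQ, if_pos hu, hf]

theorem tsum_root (k : ℕ) (hk : 0 < k) (ℓ : Fin k → ℕ) (hℓ : ∀ i, 1 ≤ ℓ i) :
    ∑' t, surv k ℓ t (Sum.inl ()) =
      ENNReal.ofReal ((∑ i, (ℓ i : ℝ)) / (∑ i, ((ℓ i : ℝ))⁻¹)) := by
  set Λ : ℝ := (∑ i, (ℓ i : ℝ)) / (∑ i, ((ℓ i : ℝ))⁻¹) with hΛ
  have hpos : ∀ i, (0 : ℝ) < ℓ i := fun i => by exact_mod_cast hℓ i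
  have : Nonempty (Fin k) := ⟨⟨0, hk⟩⟩
  have hS : 0 < ∑ i, ((ℓ i : ℝ))⁻¹ :=
    Finset.sum_pos (fun i _ => inv_pos.2 (hpos i)) Finset.univ_nonempty
  have hΛ0 : 0 ≤ Λ := div_nonneg (Finset.sum_nonneg fun i _ => (hpos i).le) hS.le
  have hΛe : Λ * ∑ i, ((ℓ i : ℝ))⁻¹ = ∑ i, (ℓ i : ℝ) := by
    exact div_mul_cancel₀ _ hS.ne'
  let R : Fin k → ℕ → ℝ := fun i j => ((ℓ i : ℝ) - j) * (j + Λ * (ℓ i : ℝ)⁻¹)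
  have hR : ∀ i j, j ≤ ℓ i → 0 ≤ R i j := by
    intro i j hj
    have h1 : (j : ℝ) ≤ ℓ i := by exact_mod_cast hj
    have := (inv_pos.2 (hpos i)).le
    exact mul_nonneg (by linarith) (by positivity)
  let H : Fin k → ℕ → ℝ≥0∞ := fun i j => ENNReal.ofReal (R i j)
  have hH0 : ∀ i, H i 0 = ENNReal.ofReal Λ := by
    intro i
    have : R i 0 = Λ := by
      have := (hpos i).ne'
      simp only [R]; field_simp; simp
    simp only [H, this]
  refine tsum_surv_eq k ℓ (armF k ℓ (ENNReal.ofReal Λ) H) ?_ ?_ (Sum.inl ())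
  · rintro (u | p) <;> exact ENNReal.ofReal_ne_top
  · rintro (⟨⟩ | ⟨i, j⟩)
    · have hn : ¬ isLeaf k ℓ (Sum.inl ()) := id
      refine killQ_nonleaf k ℓ _ _ hn _ _ (nbr_root k ℓ hℓ _ H) (deg_root k ℓ hℓ) ?_
      simp only [armF, H]
      have hk' : (0 : ℝ) < k := by exact_mod_cast hk
      rw [← ENNReal.ofReal_sum_of_nonneg (fun i _ => hR i 1 (hℓ i)), ← ENNReal.ofReal_natCast k,
        ← ENNReal.ofReal_div_of_pos hk', ← ENNReal.ofReal_one, ← ENNReal.ofReal_add zero_le_one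
        (div_nonneg (Finset.sum_nonneg fun i _ => hR i 1 (hℓ i)) hk'.le)]
      congr 1
      have e : ∑ i, R i 1 = k * (Λ - 1) := by
        have : ∀ i, R i 1 = (ℓ i : ℝ) - Λ * (ℓ i : ℝ)⁻¹ + (Λ - 1) := by
          intro i
          have := (hpos i).ne'
          simp only [R]; field_simp; push_cast; ring
        simp only [this, Finset.sum_add_distrib, Finset.sum_sub_distrib, ← Finset.mul_sum, hΛe]
        simp
        ring
      rw [e]; field_simp; ring
    · by_cases hl : isLeaf k ℓ (Sum.inr ⟨i, j⟩)
      · refine killQ_leaf k ℓ _ _ hl ?_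
        have hl' : (j : ℕ) + 1 = ℓ i := hl
        simp [armF, H, R, ← hl']
      · have hl' : ¬ ((j : ℕ) + 1 = ℓ i) := hl
        have hj : (j : ℕ) + 1 < ℓ i := by have := j.2; omega
        refine killQ_nonleaf k ℓ _ _ hl _ _ (nbr_arm k ℓ _ H hH0 i j hj) (deg_arm k ℓ i j hj) ?_
        simp only [armF, H]
        have n1 := hR i j (by omega)
        have n2 := hR i (j + 2) (by omega)
        rw [← ENNReal.ofReal_add n1 n2, ← ENNReal.ofReal_ofNat 2,
          ← ENNReal.ofReal_div_of_pos (by norm_num), ← ENNReal.ofReal_one,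
          ← ENNReal.ofReal_add zero_le_one (by positivity)]
        congr 1
        have := (hpos i).ne'
        simp only [R]; push_cast; ring

theorem filter_inst {α : Type} (s : Finset α) (p : α → Prop) (d1 d2 : DecidablePred p) :
    @Finset.filter α p d1 s = @Finset.filter α p d2 s := by
  congr

theorem expHit_formula (k : ℕ) (hk : 0 < k) (ℓ : Fin k → ℕ) (hℓ : ∀ i, 1 ≤ ℓ i) :
    expHitLeaf k ℓ = (∑ i, (ℓ i : ℝ≥0∞)) / (∑ i, ((ℓ i : ℝ≥0∞))⁻¹) := by
  have hpos : ∀ i, (0 : ℝ) < ℓ i := fun i => by exact_mod_cast hℓ i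
  have : Nonempty (Fin k) := ⟨⟨0, hk⟩⟩
  have hS : 0 < ∑ i, ((ℓ i : ℝ))⁻¹ :=
    Finset.sum_pos (fun i _ => inv_pos.2 (hpos i)) Finset.univ_nonempty
  unfold expHitLeaf
  have hw : ∀ t : ℕ, ∑ w ∈ (Finset.univ : Finset (Fin (t + 1) → StarV k ℓ)).filter
      (fun w => w 0 = Sum.inl () ∧ ∀ j, ¬ isLeaf k ℓ (w j)),
      trajP (starAdj k ℓ) w = surv k ℓ t (Sum.inl ()) := by
    intro t
    refine Eq.trans (Finset.sum_congr ?_ fun _ _ => rfl) (walk_sum_eq_surv k ℓ t (Sum.inl ()))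
    exact filter_inst _ _ _ _
  refine (tsum_congr hw).trans ?_
  rw [tsum_root k hk ℓ hℓ, ENNReal.ofReal_div_of_pos hS,
    ENNReal.ofReal_sum_of_nonneg (fun i _ => (hpos i).le),
    ENNReal.ofReal_sum_of_nonneg (fun i _ => (inv_pos.2 (hpos i)).le)]
  simp only [ENNReal.ofReal_inv_of_pos (hpos _), ENNReal.ofReal_natCast]

/-- For the star of `k ≥ 1` paths of lengths `ℓ₁, …, ℓ_k`, the expected
time `Λ` for a simple random walk started at the root to reach a leaf satisfies
(a) `Λ = (ℓ₁ + … + ℓ_k)/(ℓ₁⁻¹ + … + ℓ_k⁻¹)`, and (b) if every `ℓᵢ ≤ L` then `Λ ≤ L²`. -/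
theorem star_of_paths_hitting_time
    (k : ℕ) (hk : 0 < k) (ℓ : Fin k → ℕ) (hℓ : ∀ i, 1 ≤ ℓ i) :
    expHitLeaf k ℓ = (∑ i, (ℓ i : ℝ≥0∞)) / (∑ i, ((ℓ i : ℝ≥0∞))⁻¹)
    ∧ ∀ L : ℕ, (∀ i, ℓ i ≤ L) → expHitLeaf k ℓ ≤ (L : ℝ≥0∞) ^ 2 := by
  have ha := expHit_formula k hk ℓ hℓ
  refine ⟨ha, fun L hL => ?_⟩
  rw [ha]
  refine ENNReal.div_le_of_le_mul ?_
  rw [Finset.mul_sum]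
  refine Finset.sum_le_sum fun i _ => ?_
  have h0 : (ℓ i : ℝ≥0∞) ≠ 0 := by
    have := hℓ i
    simp; omega
  calc (ℓ i : ℝ≥0∞) = (ℓ i : ℝ≥0∞) ^ 2 * (ℓ i : ℝ≥0∞)⁻¹ := by
        rw [sq, mul_assoc, ENNReal.mul_inv_cancel h0 (ENNReal.natCast_ne_top _), mul_one]
    _ ≤ (L : ℝ≥0∞) ^ 2 * (ℓ i : ℝ≥0∞)⁻¹ := by
        have : (ℓ i : ℝ≥0∞) ≤ L := by exact_mod_cast hL i
        gcongr
end
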